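/- arXiv:math/0608189 — 2 statements merged into one kernel-verified Lean document; each statement's English description precedes it below -/
import Mathlib

section
/- Assume K satisfies (K1) and f is continuous on [0,∞). Let u be a solution of the radial equation on [0,ρ), 0<ρ≤∞, with u(0)>0 and u'(0)=0, and define the energy E(r) = |u'(r)|^p/(p'·K(r)) + F(u(r)) for r ∈ (0,ρ). Then E is differentiable on (0,ρ) with E'(r) = -(|u'(r)|^p/(p'·r·K(r)))·( p(n-1)/(p-1) + r·K'(r)/K(r) ) for every r ∈ (0,ρ); in particular, since n>p and (K1) holds, the factor p(n-1)/(p-1) + rK'(r)/K(r) is strictly positive and E is nonincreasing on (0,ρ). -/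
open Set Filter Topology MeasureTheory
open scoped ENNReal NNReal

noncomputable section

/-- `φ_p(s) = |s|^{p-2} s` (with the convention `φ_p(0)=0`). -/
def phiP (p s : ℝ) : ℝ := |s| ^ (p - 2) * s

/-- `K` is strictly positive and `C¹` on `(0,∞)` and satisfies condition (K1):
the map `r ↦ p + r·K'(r)/K(r)` is strictly positive and decreasing on `(0,∞)`. -/
def CondK1 (p : ℝ) (K : ℝ → ℝ) : Prop :=
  (∀ r : ℝ, 0 < r → 0 < K r) ∧ ContDiffOn ℝ 1 K (Ioi 0) ∧
  (∀ r : ℝ, 0 < r → 0 < p + r * deriv K r / K r) ∧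
  AntitoneOn (fun r => p + r * deriv K r / K r) (Ioi 0)

/-- (f1): `f(0)=0`, `f>0` above `u₀`, `f≤0` and not identically `0` on `(0,u₀)`. -/
def CondF1 (f : ℝ → ℝ) (u₀ : ℝ) : Prop :=
  f 0 = 0 ∧ (∀ v : ℝ, u₀ < v → 0 < f v) ∧ (∀ v ∈ Ioo 0 u₀, f v ≤ 0) ∧
  ∃ v ∈ Ioo 0 u₀, f v ≠ 0

/-- (f2): `f` is continuous on `[0,∞)` and locally Lipschitz on `[u₀,∞)`. -/
def CondF2 (f : ℝ → ℝ) (u₀ : ℝ) : Prop :=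
  ContinuousOn f (Ici 0) ∧ LocallyLipschitzOn (Ici u₀) f

/-- `D`: the set of differentiability points of `f` within `[u₀,∞)`. -/
def Dset (f : ℝ → ℝ) (u₀ : ℝ) : Set ℝ :=
  {v | v ∈ Ici u₀ ∧ DifferentiableWithinAt ℝ f (Ici u₀) v}

/-- the (one-sided) derivative `f'` of `f` on `[u₀,∞)`. -/
def fder (f : ℝ → ℝ) (u₀ : ℝ) (v : ℝ) : ℝ := derivWithin f (Ici u₀) v

/-- (f3): `(p-1)f(u) ≤ f'(u)(u-u₀)` on `D`. -/
def CondF3 (p : ℝ) (f : ℝ → ℝ) (u₀ : ℝ) : Prop :=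
  ∀ v ∈ Dset f u₀, (p - 1) * f v ≤ fder f u₀ v * (v - u₀)

/-- (f4): `u ↦ u·f'(u)/f(u)` is decreasing on `D`. -/
def CondF4 (f : ℝ → ℝ) (u₀ : ℝ) : Prop :=
  AntitoneOn (fun v => v * fder f u₀ v / f v) (Dset f u₀)

/-- `u` is a solution of the radial equation
`(r^{n-1} φ_p(u'))' = -r^{n-1} K(r) f(u)` on the interval `I ⊆ [0,∞)`, `0 ∈ I`:
`u ∈ C¹(I)`, `r ↦ r^{n-1} φ_p(u'(r))` is `C¹` on `I` and the equation holds for `r ∈ I`, `r>0`. -/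
def IsRadialSolution (p : ℝ) (n : ℕ) (K f : ℝ → ℝ) (I : Set ℝ) (u : ℝ → ℝ) : Prop :=
  (0:ℝ) ∈ I ∧ I ⊆ Ici 0 ∧
  ContDiffOn ℝ 1 u I ∧
  ContDiffOn ℝ 1 (fun r => r ^ (n - 1) * phiP p (derivWithin u I r)) I ∧
  ∀ r ∈ I, 0 < r →
    HasDerivWithinAt (fun r => r ^ (n - 1) * phiP p (derivWithin u I r))
      (-(r ^ (n - 1) * K r * f (u r))) I r

/-- `F(s) = ∫₀^s f(t) dt`. -/
def Fint (f : ℝ → ℝ) (s : ℝ) : ℝ := ∫ t in (0:ℝ)..s, f t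

theorem abs_phiP {p s : ℝ} (hs : s ≠ 0) : |phiP p s| = |s| ^ (p - 1) := by
  rw [phiP, abs_mul, abs_of_nonneg (Real.rpow_nonneg (abs_nonneg s) _),
    ← Real.rpow_add_one (abs_ne_zero.2 hs)]
  ring_nf

theorem abs_phiP_rpow {p : ℝ} (hp : 1 < p) (s : ℝ) : |phiP p s| ^ (p / (p - 1)) = |s| ^ p := by
  have hp1 : p - 1 ≠ 0 := by linarith
  rcases eq_or_ne s 0 with rfl | hs
  · have h : p / (p - 1) ≠ 0 := div_ne_zero (by linarith) hp1
    simp [phiP, Real.zero_rpow h, Real.zero_rpow (show p ≠ 0 by linarith)]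
  · rw [abs_phiP hs, ← Real.rpow_mul (abs_nonneg s), mul_div_cancel₀ _ hp1]

theorem phiP_conjExponent_phiP {p : ℝ} (hp : 1 < p) (s : ℝ) :
    phiP (p / (p - 1)) (phiP p s) = s := by
  have hp1 : p - 1 ≠ 0 := by linarith
  rcases eq_or_ne s 0 with rfl | hs
  · simp [phiP]
  · have hs' : 0 < |s| := abs_pos.2 hs
    rw [phiP, abs_phiP hs, ← Real.rpow_mul (abs_nonneg s), phiP, ← mul_assoc, ← Real.rpow_add hs',
      show (p - 1) * (p / (p - 1) - 2) + (p - 2) = 0 by field_simp; ring, Real.rpow_zero, one_mul]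

theorem self_mul_phiP {p : ℝ} (hp : 1 < p) (s : ℝ) : s * phiP p s = |s| ^ p := by
  rcases eq_or_ne s 0 with rfl | hs
  · simp [phiP, Real.zero_rpow (show p ≠ 0 by linarith)]
  · have hs' : 0 < |s| := abs_pos.2 hs
    rw [phiP, mul_left_comm, ← abs_mul_abs_self s, ← pow_two, ← Real.rpow_natCast,
      ← Real.rpow_add hs']
    norm_num

/-- Chain rule for `|v|^p` when only `φ_p ∘ v` is known to be differentiable. -/
theorem HasDerivAt.abs_rpow_of_phiP {p : ℝ} (hp : 1 < p) {v : ℝ → ℝ} {w' r : ℝ}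
    (hw : HasDerivAt (fun x => phiP p (v x)) w' r) :
    HasDerivAt (fun x => |v x| ^ p) (p / (p - 1) * v r * w') r := by
  have hq : 1 < p / (p - 1) := (one_lt_div (by linarith)).2 (by linarith)
  have h := (hasDerivAt_abs_rpow (phiP p (v r)) hq).comp r hw
  have e : p / (p - 1) * |phiP p (v r)| ^ (p / (p - 1) - 2) * phiP p (v r) =
      p / (p - 1) * v r := by
    conv_rhs => rw [← phiP_conjExponent_phiP hp (v r)]
    rw [mul_assoc]
    rfl
  rw [e] at h
  refine h.congr_of_eventuallyEq (Eventually.of_forall fun x => ?_)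
  exact (abs_phiP_rpow hp (v x)).symm

theorem IsCompact.continuousOn_image_of_comp {X Y Z : Type*} [TopologicalSpace X]
    [TopologicalSpace Y] [T2Space Y] [TopologicalSpace Z] {s : Set X} (hs : IsCompact s)
    {u : X → Y} {f : Y → Z} (hu : ContinuousOn u s) (hfu : ContinuousOn (fun x => f (u x)) s) :
    ContinuousOn f (u '' s) := by
  have : CompactSpace s := isCompact_iff_compactSpace.1 hs
  have hc : Continuous ((mapsTo_image u s).restrict u s (u '' s)) := hu.mapsToRestrict _
  have hq : IsQuotientMap ((mapsTo_image u s).restrict u s (u '' s)) :=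
    IsQuotientMap.of_surjective_continuous (surjective_mapsTo_image_restrict u s) hc
  rw [continuousOn_iff_continuous_domRestrict, hq.continuous_iff]
  exact continuousOn_iff_continuous_domRestrict.1 hfu

theorem hasDerivAt_Fint_comp {f u : ℝ → ℝ} {m r u' : ℝ} (hm : m ≤ 0)
    (hf : ContinuousOn f (Ici m)) (hu : HasDerivAt u u' r) (hmu : ∀ᶠ x in 𝓝 r, m ≤ u x) :
    HasDerivAt (fun x => Fint f (u x)) (f (u r) * u') r := by
  have hg : Continuous fun x => f (max m x) :=
    hf.comp_continuous (by fun_prop) fun x => mem_Ici.2 (le_max_left m x)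
  have h := (intervalIntegral.integral_hasDerivAt_right (hg.intervalIntegrable 0 (u r))
    (hg.stronglyMeasurableAtFilter _ _) hg.continuousAt).comp r hu
  rw [max_eq_right hmu.self_of_nhds] at h
  refine h.congr_of_eventuallyEq ?_
  filter_upwards [hmu] with x hx
  refine intervalIntegral.integral_congr fun t ht => ?_
  have : m ≤ t := (le_inf hm hx).trans ht.1
  simp [max_eq_right this]

/-- If `f` is continuous on `[0,∞)`, `u a > 0` and `f ∘ u` is continuous on `[a,b]`, then `f` is
continuous on a half-line containing `0` and the values of `u` on `[a,b]`. -/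
theorem exists_continuousOn_Ici_of_comp {f u : ℝ → ℝ} {a b : ℝ} (hab : a ≤ b)
    (hf : ContinuousOn f (Ici 0)) (hu : ContinuousOn u (Icc a b)) (ha : 0 < u a)
    (hfu : ContinuousOn (fun x => f (u x)) (Icc a b)) :
    ∃ m ≤ 0, ContinuousOn f (Ici m) ∧ ∀ x ∈ Icc a b, m ≤ u x := by
  obtain ⟨c, hc, hmin⟩ := isCompact_Icc.exists_isMinOn (nonempty_Icc.2 hab) hu
  refine ⟨min 0 (u c), min_le_left _ _, ?_, fun x hx => (min_le_right _ _).trans (hmin hx)⟩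
  refine (hf.union_of_isClosed (isCompact_Icc.continuousOn_image_of_comp hu hfu) isClosed_Ici
    (isCompact_Icc.image_of_continuousOn hu).isClosed).mono fun y hy => ?_
  rcases le_or_gt 0 y with h0 | h0
  · exact Or.inl h0
  · right
    have hcy : u c ≤ y := (min_le_iff.1 hy).resolve_left h0.not_ge
    exact isPreconnected_Icc.intermediate_value hc (left_mem_Icc.2 hab) hu
      ⟨hcy, (h0.trans ha).le⟩

theorem IsRadialSolution.continuousOn_comp {p : ℝ} {n : ℕ} {K f u : ℝ → ℝ} {I : Set ℝ}
    (hu : IsRadialSolution p n K f I u) (hI : UniqueDiffOn ℝ I)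
    (hKpos : ∀ r : ℝ, 0 < r → 0 < K r) (hK : ContinuousOn K (Ioi 0)) :
    ContinuousOn (fun r => f (u r)) (I ∩ Ioi 0) := by
  obtain ⟨-, -, -, hw, heq⟩ := hu
  have hd := hw.continuousOn_derivWithin hI le_rfl
  have hne : ∀ r ∈ I ∩ Ioi 0, r ^ (n - 1) * K r ≠ 0 := fun r hr =>
    (mul_pos (pow_pos hr.2 _) (hKpos r hr.2)).ne'
  have hden : ContinuousOn (fun r => r ^ (n - 1) * K r) (I ∩ Ioi 0) :=
    (continuous_pow _).continuousOn.mul (hK.mono inter_subset_right)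
  refine ((hd.mono inter_subset_left).neg.div hden hne).congr fun r hr => ?_
  have := hne r hr
  rw [Pi.div_apply, Pi.neg_apply, (heq r hr.1 hr.2).derivWithin (hI r hr.1), neg_neg,
    mul_div_cancel_left₀ _ this]

theorem IsRadialSolution.hasDerivAt_phiP {p : ℝ} {n : ℕ} {K f u : ℝ → ℝ} {I : Set ℝ}
    (hu : IsRadialSolution p n K f I u) (hn : 1 ≤ n) {r : ℝ} (hr : 0 < r) (hI : I ∈ 𝓝 r) :
    HasDerivAt (fun x => phiP p (derivWithin u I x))
      (-(K r * f (u r)) - ((n : ℝ) - 1) / r * phiP p (derivWithin u I r)) r := by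
  have hw := (hu.2.2.2.2 r (mem_of_mem_nhds hI) hr).hasDerivAt hI
  obtain ⟨k, rfl⟩ : ∃ k, n = k + 1 := ⟨n - 1, by omega⟩
  simp only [Nat.add_sub_cancel] at hw
  have h := hw.div (hasDerivAt_pow k r) (pow_pos hr k).ne'
  refine HasDerivAt.congr_of_eventuallyEq (h.congr_deriv ?_) ?_
  · rcases k with _ | k
    · simp
    · have := hr.ne'
      push_cast
      field_simp
      ring
  · filter_upwards [lt_mem_nhds hr] with x hx
    have := (pow_pos hx k).ne'
    exact (mul_div_cancel_left₀ _ this).symm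

theorem IsRadialSolution.hasDerivAt_Fint {p : ℝ} {n : ℕ} {K f u : ℝ → ℝ} {I : Set ℝ}
    (hu : IsRadialSolution p n K f I u) (hI : UniqueDiffOn ℝ I) (hconn : I.OrdConnected)
    (hKpos : ∀ r : ℝ, 0 < r → 0 < K r) (hK : ContinuousOn K (Ioi 0))
    (hf : ContinuousOn f (Ici 0)) (hu0 : 0 < u 0) {r : ℝ} (hr : 0 < r) (hIr : I ∈ 𝓝 r) :
    HasDerivAt (fun x => Fint f (u x)) (f (u r) * derivWithin u I r) r := by
  have hrI := mem_of_mem_nhds hIr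
  have huc : ContinuousOn u I := hu.2.2.1.continuousOn
  obtain ⟨b, hb, hrb : r < b⟩ : (I ∩ Ioi r).Nonempty :=
    nonempty_of_mem (inter_mem (mem_nhdsWithin_of_mem_nhds hIr) (self_mem_nhdsWithin (s := Ioi r)))
  have hsub : Icc 0 b ⊆ I := hconn.out hu.1 hb
  obtain ⟨a, ⟨ha, har⟩, hua⟩ : ∃ a ∈ Ioo 0 r, 0 < u a := by
    have h1 : ∀ᶠ x in 𝓝[I] 0, 0 < u x := (huc 0 hu.1).eventually (lt_mem_nhds hu0)
    have h2 : ∀ᶠ x in 𝓝[>] (0 : ℝ), 0 < u x :=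
      h1.filter_mono (nhdsWithin_le_of_mem (mem_of_superset (Ioo_mem_nhdsGT (hr.trans hrb))
        (Ioo_subset_Icc_self.trans hsub)))
    exact (Filter.Eventually.and (Ioo_mem_nhdsGT hr) h2).exists
  have hab : Icc a b ⊆ I ∩ Ioi 0 := fun x hx => ⟨hsub ⟨ha.le.trans hx.1, hx.2⟩, ha.trans_le hx.1⟩
  obtain ⟨m, hm, hfm, hmu⟩ := exists_continuousOn_Ici_of_comp (har.trans hrb).le hf
    (huc.mono (hab.trans inter_subset_left)) hua ((hu.continuousOn_comp hI hKpos hK).mono hab)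
  have hd : HasDerivAt u (derivWithin u I r) r :=
    ((hu.2.2.1.differentiableOn one_ne_zero r hrI).hasDerivWithinAt).hasDerivAt hIr
  exact hasDerivAt_Fint_comp hm hfm hd (eventually_of_mem (Icc_mem_nhds har hrb) hmu)

/-- The energy `E(r) = |u'(r)|^p/(p' K(r)) + F(u(r))` satisfies
`E'(r) = -(|u'|^p/(p' r K(r)))(p(n-1)/(p-1) + rK'/K)`; the last factor is
strictly positive and `E` is nonincreasing. -/
theorem energy_is_decreasing
    (p : ℝ) (n : ℕ) (hp : 1 < p) (hn : p < n)
    (K f : ℝ → ℝ) (hK : CondK1 p K) (hf : ContinuousOn f (Ici 0))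
    (I : Set ℝ) (hI : I = Ici 0 ∨ ∃ ρ : ℝ, 0 < ρ ∧ I = Ico 0 ρ)
    (u : ℝ → ℝ) (hu : IsRadialSolution p n K f I u)
    (hu0 : 0 < u 0) (hu'0 : derivWithin u I 0 = 0) :
    (∀ r ∈ I, 0 < r →
      HasDerivAt
        (fun r => |derivWithin u I r| ^ p / ((p / (p - 1)) * K r) + Fint f (u r))
        (-(|derivWithin u I r| ^ p / ((p / (p - 1)) * r * K r)) *
          (p * ((n : ℝ) - 1) / (p - 1) + r * deriv K r / K r)) r) ∧
    (∀ r ∈ I, 0 < r → 0 < p * ((n : ℝ) - 1) / (p - 1) + r * deriv K r / K r) ∧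
    AntitoneOn
      (fun r => |derivWithin u I r| ^ p / ((p / (p - 1)) * K r) + Fint f (u r))
      (I ∩ Ioi 0) := by
  have hp1 : 0 < p - 1 := by linarith
  have hconv : Convex ℝ I := by
    rcases hI with rfl | ⟨ρ, -, rfl⟩
    exacts [convex_Ici 0, convex_Ico 0 ρ]
  have hnhds : ∀ r ∈ I, 0 < r → I ∈ 𝓝 r := by
    rcases hI with rfl | ⟨ρ, -, rfl⟩
    exacts [fun r _ h => Ici_mem_nhds h, fun r hr h => Ico_mem_nhds h hr.2]
  have huniq : UniqueDiffOn ℝ I := by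
    rcases hI with rfl | ⟨ρ, -, rfl⟩
    exacts [uniqueDiffOn_Ici 0, uniqueDiffOn_Ico 0 ρ]
  obtain ⟨hKpos, hKc, hKp, -⟩ := hK
  have hderiv : ∀ r ∈ I, 0 < r →
      HasDerivAt
        (fun r => |derivWithin u I r| ^ p / ((p / (p - 1)) * K r) + Fint f (u r))
        (-(|derivWithin u I r| ^ p / ((p / (p - 1)) * r * K r)) *
          (p * ((n : ℝ) - 1) / (p - 1) + r * deriv K r / K r)) r := by
    intro r hr h0
    have hKr := hKpos r h0
    have hKd : HasDerivAt K (deriv K r) r :=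
      ((hKc.differentiableOn one_ne_zero).differentiableAt (Ioi_mem_nhds h0)).hasDerivAt
    have hv := (hu.hasDerivAt_phiP (Nat.one_le_cast.1 (hp.trans hn).le) h0
      (hnhds r hr h0)).abs_rpow_of_phiP hp
    have hF := hu.hasDerivAt_Fint huniq hconv.ordConnected hKpos hKc.continuousOn hf hu0 h0
      (hnhds r hr h0)
    refine ((hv.div (hKd.const_mul (p / (p - 1))) (by positivity)).add hF).congr_deriv ?_
    rw [← self_mul_phiP hp]
    have := hp1.ne'
    field_simp
    ring
  have hpos : ∀ r ∈ I, 0 < r → 0 < p * ((n : ℝ) - 1) / (p - 1) + r * deriv K r / K r := by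
    intro r _ h0
    have h : p ≤ p * ((n : ℝ) - 1) / (p - 1) := by
      rw [le_div_iff₀ hp1]
      exact mul_le_mul_of_nonneg_left (by linarith) (by linarith)
    linarith [hKp r h0]
  refine ⟨hderiv, hpos, antitoneOn_of_deriv_nonpos (hconv.inter (convex_Ioi 0))
    (fun r hr => (hderiv r hr.1 hr.2).continuousAt.continuousWithinAt)
    (fun r hr => ?_) (fun r hr => ?_)⟩
  · have hr := interior_subset hr
    exact (hderiv r hr.1 hr.2).differentiableAt.differentiableWithinAt
  · have hr := interior_subset hr
    have h0 : 0 < r := hr.2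
    have hKr := hKpos r h0
    rw [(hderiv r hr.1 hr.2).deriv]
    exact mul_nonpos_of_nonpos_of_nonneg (neg_nonpos.2 (by positivity)) (hpos r hr.1 h0).le
end
end

section
/- Assume K satisfies (K1) and f satisfies (f1) and (f2). Then for every α>u₀ one has u(R(α),α) ≤ u₀; that is, the limiting value of the solution u(·,α) at the right endpoint of its interval of monotone positivity never exceeds u₀. -/
open Set Filter Topology MeasureTheory
open scoped ENNReal NNReal

noncomputable section

/-- the derivative `u'` of a solution defined on `[0,∞)` (one-sided at `0`). -/
def uderiv (u : ℝ → ℝ) : ℝ → ℝ := derivWithin u (Ici 0)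

/-- `R(α) = sup {r>0 : u(t,α)>0 and u'(t,α)<0 for all t ∈ (0,r)}`,
as an extended nonnegative real (it may be `∞`). -/
def Rend (u : ℝ → ℝ) : ℝ≥0∞ :=
  sSup {R : ℝ≥0∞ | ∀ t : ℝ, 0 < t → ENNReal.ofReal t < R → 0 < u t ∧ uderiv u t < 0}

/-- the filter describing the approach `r → R⁻` to the right endpoint `R`
(`r → ∞` when `R = ∞`). -/
def endFilter (R : ℝ≥0∞) : Filter ℝ :=
  if R = ⊤ then atTop else 𝓝[<] R.toReal

/-- `u : α ↦ u(·,α)` is the family of solutions of the initial value problems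
(`u(0,α)=α`, `u'(0,α)=0`) for `α > u₀`, depending continuously on `(α,r)`
together with its derivative. -/
def IsFamily (p : ℝ) (n : ℕ) (K f : ℝ → ℝ) (u₀ : ℝ) (u : ℝ → ℝ → ℝ) : Prop :=
  (∀ α : ℝ, u₀ < α →
    IsRadialSolution p n K f (Ici 0) (u α) ∧ u α 0 = α ∧ uderiv (u α) 0 = 0) ∧
  ContinuousOn (fun q : ℝ × ℝ => u q.1 q.2) (Ioi u₀ ×ˢ Ici 0) ∧
  ContinuousOn (fun q : ℝ × ℝ => uderiv (u q.1) q.2) (Ioi u₀ ×ˢ Ici 0)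

/-- the set `N` of initial values of crossing solutions; here `uR α` denotes the
limiting value `u(R(α),α)`. -/
def Ncross (u : ℝ → ℝ → ℝ) (uR : ℝ → ℝ) (u₀ : ℝ) : Set ℝ :=
  {α | u₀ < α ∧ uR α = 0 ∧
    ∃ L : ℝ, L < 0 ∧ Tendsto (uderiv (u α)) (endFilter (Rend (u α))) (𝓝 L)}

/-- the set `G` of initial values of ground state solutions. -/
def Gset (u : ℝ → ℝ → ℝ) (uR : ℝ → ℝ) (u₀ : ℝ) : Set ℝ :=
  {α | u₀ < α ∧ uR α = 0 ∧
    Tendsto (uderiv (u α)) (endFilter (Rend (u α))) (𝓝 0)}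

/-- the set `P` of initial values of positive solutions. -/
def Pset (uR : ℝ → ℝ) (u₀ : ℝ) : Set ℝ := {α | u₀ < α ∧ 0 < uR α}

/-- `t(s,α)`: the first point at which the solution `u(·,α)` takes the value `s`
(the unique `r ∈ [0,R(α))` with `u(r,α)=s` when `s` is attained there). -/
def tInv (u : ℝ → ℝ) (s : ℝ) : ℝ := sInf {r : ℝ | 0 ≤ r ∧ u r = s}

lemma phiP_neg_iff (p : ℝ) {s : ℝ} : phiP p s < 0 ↔ s < 0 := by
  unfold phiP
  constructor
  · intro h
    by_contra! hs
    exact absurd h (not_lt.2 (by positivity))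
  · intro h
    exact mul_neg_of_pos_of_neg (Real.rpow_pos_of_pos (abs_pos.2 h.ne) _) h

lemma phiP_of_neg (p : ℝ) {s : ℝ} (hs : s < 0) : phiP p s = -(-s) ^ (p - 1) := by
  unfold phiP
  rw [abs_of_neg hs, show p - 1 = (p - 2) + 1 by ring, Real.rpow_add_one (by linarith)]
  ring

lemma IsRadialSolution.hasDerivAt {p : ℝ} {n : ℕ} {K f u : ℝ → ℝ}
    (hu : IsRadialSolution p n K f (Ici 0) u) {r : ℝ} (hr : 0 < r) :
    HasDerivAt u (uderiv u r) r :=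
  ((hu.2.2.1.differentiableOn one_ne_zero r hr.le).hasDerivWithinAt).hasDerivAt
    (Ici_mem_nhds hr)

lemma IsRadialSolution.hasDerivAt_flux {p : ℝ} {n : ℕ} {K f u : ℝ → ℝ}
    (hu : IsRadialSolution p n K f (Ici 0) u) {r : ℝ} (hr : 0 < r) :
    HasDerivAt (fun r => r ^ (n - 1) * phiP p (uderiv u r))
      (-(r ^ (n - 1) * K r * f (u r))) r :=
  (hu.2.2.2.2 r hr.le hr).hasDerivAt (Ici_mem_nhds hr)

/-- As long as the solution stays above `u₀`, its derivative is negative. -/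
lemma IsRadialSolution.uderiv_neg {p : ℝ} {n : ℕ} {K f u : ℝ → ℝ} {u₀ : ℝ}
    (hu : IsRadialSolution p n K f (Ici 0) u) (hn : 2 ≤ n)
    (hK : ∀ r, 0 < r → 0 < K r) (hf : ∀ v, u₀ < v → 0 < f v) {r : ℝ} (hr : 0 < r)
    (hu₀ : ∀ t ∈ Ico 0 r, u₀ < u t) : uderiv u r < 0 := by
  have hanti : StrictAntiOn (fun r => r ^ (n - 1) * phiP p (uderiv u r)) (Icc 0 r) := by
    refine strictAntiOn_of_deriv_neg (convex_Icc 0 r)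
      (hu.2.2.2.1.continuousOn.mono Icc_subset_Ici_self) fun t ht => ?_
    rw [interior_Icc] at ht
    rw [(hu.hasDerivAt_flux ht.1).deriv]
    have := hK t ht.1
    have := hf _ (hu₀ t ⟨ht.1.le, ht.2⟩)
    have := ht.1
    exact neg_neg_of_pos (by positivity)
  have h := hanti (left_mem_Icc.2 hr.le) (right_mem_Icc.2 hr.le) hr
  simp only [zero_pow (show n - 1 ≠ 0 by omega), zero_mul] at h
  exact (phiP_neg_iff p).1 ((pos_iff_neg_of_mul_neg h).1 (by positivity))

lemma IsRadialSolution.strictAntiOn {p : ℝ} {n : ℕ} {K f u : ℝ → ℝ}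
    (hu : IsRadialSolution p n K f (Ici 0) u) {r : ℝ}
    (h : ∀ t ∈ Ioo 0 r, uderiv u t < 0) : StrictAntiOn u (Icc 0 r) := by
  refine strictAntiOn_of_deriv_neg (convex_Icc 0 r)
    (hu.2.2.1.continuousOn.mono Icc_subset_Ici_self) fun t ht => ?_
  rw [interior_Icc] at ht
  rw [(hu.hasDerivAt ht.1).deriv]
  exact h t ht

lemma pos_and_uderiv_neg_of_lt_Rend {u : ℝ → ℝ} {t : ℝ} (ht : 0 < t)
    (h : ENNReal.ofReal t < Rend u) : 0 < u t ∧ uderiv u t < 0 := by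
  obtain ⟨R, hR, htR⟩ := lt_sSup_iff.1 h
  exact hR t ht htR

lemma IsRadialSolution.ofReal_le_Rend {p : ℝ} {n : ℕ} {K f u : ℝ → ℝ} {u₀ : ℝ}
    (hu : IsRadialSolution p n K f (Ici 0) u) (hn : 2 ≤ n) (hu₀ : 0 < u₀)
    (hK : ∀ r, 0 < r → 0 < K r) (hf : ∀ v, u₀ < v → 0 < f v) {r : ℝ}
    (h : ∀ t ∈ Ico 0 r, u₀ < u t) : ENNReal.ofReal r ≤ Rend u := by
  refine le_sSup fun t ht htr => ?_
  have htr : t < r := (ENNReal.ofReal_lt_ofReal_iff_of_nonneg ht.le).1 htr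
  exact ⟨hu₀.trans (h t ⟨ht.le, htr⟩),
    hu.uderiv_neg hn hK hf ht fun s hs => h s ⟨hs.1, hs.2.trans htr⟩⟩

/-- Under (K1) the weight decays at most like `r ^ (-p)`. -/
lemma CondK1.monotoneOn_rpow_mul {p : ℝ} {K : ℝ → ℝ} (hK : CondK1 p K) :
    MonotoneOn (fun r => r ^ p * K r) (Ioi 0) := by
  obtain ⟨hpos, hC, hlog, -⟩ := hK
  have hd : ∀ r : ℝ, 0 < r → HasDerivAt (fun r => r ^ p * K r)
      (p * r ^ (p - 1) * K r + r ^ p * deriv K r) r := fun r hr =>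
    (Real.hasDerivAt_rpow_const (Or.inl hr.ne')).mul
      ((hC.differentiableOn one_ne_zero).differentiableAt (Ioi_mem_nhds hr)).hasDerivAt
  refine monotoneOn_of_deriv_nonneg (convex_Ioi 0)
    (fun r hr => (hd r hr).continuousAt.continuousWithinAt)
    (fun r hr => ?_) fun r hr => ?_
  · rw [interior_Ioi] at hr
    exact (hd r hr).differentiableAt.differentiableWithinAt
  · rw [interior_Ioi] at hr
    have hr' : 0 < r := hr
    rw [(hd r hr).deriv]
    have hKr := hpos r hr
    have h1 := hlog r hr
    have h2 : p * r ^ (p - 1) * K r + r ^ p * deriv K r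
        = r ^ (p - 1) * K r * (p + r * deriv K r / K r) := by
      have : r ^ p = r ^ (p - 1) * r := by
        rw [← Real.rpow_add_one hr'.ne']; simp
      rw [this]; field_simp
    rw [h2]; positivity

/-- If `f(u)` stays bounded below by a positive constant, the flux grows at least like
`r ^ (n - p)`. -/
lemma IsRadialSolution.flux_le {p : ℝ} {n : ℕ} {K f u : ℝ → ℝ} {m : ℝ}
    (hu : IsRadialSolution p n K f (Ici 0) u) (hn : 1 ≤ n) (hpn : p < n) (hK : CondK1 p K)
    (hm : 0 < m) (hfm : ∀ r, 1 < r → m ≤ f (u r)) (hneg : uderiv u 1 < 0) :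
    ∃ C : ℝ, 0 < C ∧ ∀ r : ℝ, 1 ≤ r →
      r ^ (n - 1) * phiP p (uderiv u r) ≤ -(C * r ^ ((n : ℝ) - p)) := by
  have hK1 : 0 < K 1 := hK.1 1 one_pos
  have hφ := (phiP_neg_iff p).2 hneg
  have hnp : 0 < (n : ℝ) - p := sub_pos.2 hpn
  set C := min (m * K 1 / (n - p)) (-phiP p (uderiv u 1))
  have hC : 0 < C := lt_min (by positivity) (by linarith)
  have hd : ∀ r : ℝ, 0 < r → HasDerivAt
      (fun r => r ^ (n - 1) * phiP p (uderiv u r) + C * r ^ ((n : ℝ) - p))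
      (-(r ^ (n - 1) * K r * f (u r)) + C * ((n - p) * r ^ ((n : ℝ) - p - 1))) r :=
    fun r hr => (hu.hasDerivAt_flux hr).add
      ((Real.hasDerivAt_rpow_const (Or.inl hr.ne')).const_mul C)
  have hanti : AntitoneOn
      (fun r => r ^ (n - 1) * phiP p (uderiv u r) + C * r ^ ((n : ℝ) - p)) (Ici 1) := by
    refine antitoneOn_of_deriv_nonpos (convex_Ici 1)
      (fun r hr => (hd r (one_pos.trans_le hr)).continuousAt.continuousWithinAt)
      (fun r hr => ?_) fun r hr => ?_
    · rw [interior_Ici] at hr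
      exact (hd r (one_pos.trans hr)).differentiableAt.differentiableWithinAt
    · rw [interior_Ici] at hr
      have hr0 : 0 < r := one_pos.trans hr
      rw [(hd r hr0).deriv]
      have hKr : K 1 ≤ r ^ p * K r := by
        simpa using hK.monotoneOn_rpow_mul (mem_Ioi.2 one_pos) (mem_Ioi.2 hr0) (le_of_lt hr)
      have hpow : r ^ (n - 1) = r ^ ((n : ℝ) - p - 1) * r ^ p := by
        rw [← Real.rpow_add hr0, ← Real.rpow_natCast, Nat.cast_sub hn]
        congr 1; push_cast; ring
      have hC1 : C * (n - p) ≤ m * K 1 := (le_div_iff₀ hnp).1 (min_le_left _ _)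
      have h1 : m * K 1 ≤ f (u r) * (r ^ p * K r) :=
        mul_le_mul (hfm r hr) hKr hK1.le (hm.le.trans (hfm r hr))
      have h2 := mul_le_mul_of_nonneg_left (hC1.trans h1)
        (Real.rpow_pos_of_pos hr0 ((n : ℝ) - p - 1)).le
      rw [hpow]
      linarith
  refine ⟨C, hC, fun r hr => ?_⟩
  have h := hanti (mem_Ici.2 le_rfl) (mem_Ici.2 hr) hr
  have hC2 : C ≤ -phiP p (uderiv u 1) := min_le_right _ _
  simp only [one_pow, Real.one_rpow] at h
  linarith

/-- A solution decreasing on all of `[0,∞)` cannot converge to a limit above `u₀`. -/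
lemma IsRadialSolution.limit_atTop_le {p : ℝ} {n : ℕ} {K f u : ℝ → ℝ} {u₀ l : ℝ}
    (hu : IsRadialSolution p n K f (Ici 0) u) (hp : 1 < p) (hpn : p < n) (hu₀ : 0 < u₀)
    (hK : CondK1 p K) (hf : ∀ v, u₀ < v → 0 < f v) (hfc : ContinuousOn f (Ici 0))
    (hneg : ∀ t, 0 < t → uderiv u t < 0) (hl : Tendsto u atTop (𝓝 l)) : l ≤ u₀ := by
  by_contra! hlt
  have hn : 1 ≤ n := by
    have : (1 : ℝ) < n := hp.trans hpn
    exact_mod_cast this.le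
  have hanti : ∀ s t, 0 ≤ s → s ≤ t → u t ≤ u s := fun s t hs hst =>
    (hu.strictAntiOn (r := t) fun x hx => hneg x hx.1).antitoneOn ⟨hs, hst⟩
      ⟨hs.trans hst, le_rfl⟩ hst
  have hle : ∀ r, 0 ≤ r → l ≤ u r := fun r hr =>
    le_of_tendsto hl ((eventually_ge_atTop r).mono fun t ht => hanti r t hr ht)
  obtain ⟨x, hx, hmin⟩ := isCompact_Icc.exists_isMinOn (nonempty_Icc.2 (hle 0 le_rfl))
    (hfc.mono fun v hv => hu₀.le.trans (hlt.le.trans hv.1))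
  obtain ⟨C, hC, hflux⟩ := hu.flux_le hn hpn hK (hf x (hlt.trans_le hx.1))
    (fun r hr => isMinOn_iff.1 hmin _
      ⟨hle r (one_pos.trans hr).le, hanti 0 r le_rfl (one_pos.trans hr).le⟩) (hneg 1 one_pos)
  set c := C ^ (p - 1)⁻¹
  have hc : 0 < c := Real.rpow_pos_of_pos hC _
  have hp1 : 0 < p - 1 := sub_pos.2 hp
  have hder : ∀ r : ℝ, 1 ≤ r → uderiv u r ≤ -(c / r) := by
    intro r hr
    have hr0 : 0 < r := one_pos.trans_le hr
    have hur := hneg r hr0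
    have h := hflux r hr
    rw [phiP_of_neg p hur] at h
    have hpow : r ^ (n - 1) = r ^ ((n : ℝ) - p) * r ^ (p - 1) := by
      rw [← Real.rpow_add hr0, ← Real.rpow_natCast, Nat.cast_sub hn]
      congr 1; push_cast; ring
    have h1 : C ≤ (r * -uderiv u r) ^ (p - 1) := by
      rw [Real.mul_rpow hr0.le (by linarith)]
      refine le_of_mul_le_mul_left ?_ (Real.rpow_pos_of_pos hr0 ((n : ℝ) - p))
      rw [hpow] at h
      linarith
    have h2 : c ≤ r * -uderiv u r :=
      (Real.rpow_inv_le_iff_of_pos hC.le (mul_nonneg hr0.le (by linarith)) hp1).2 h1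
    have h3 : c / r ≤ -uderiv u r := (div_le_iff₀' hr0).2 h2
    linarith
  have hd : ∀ r : ℝ, 0 < r →
      HasDerivAt (fun r => u r + c * Real.log r) (uderiv u r + c * r⁻¹) r :=
    fun r hr => (hu.hasDerivAt hr).add ((Real.hasDerivAt_log hr.ne').const_mul c)
  have hlog : AntitoneOn (fun r => u r + c * Real.log r) (Ici 1) := by
    refine antitoneOn_of_deriv_nonpos (convex_Ici 1)
      (fun r hr => (hd r (one_pos.trans_le hr)).continuousAt.continuousWithinAt)
      (fun r hr => ?_) fun r hr => ?_
    · rw [interior_Ici] at hr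
      exact (hd r (one_pos.trans hr)).differentiableAt.differentiableWithinAt
    · rw [interior_Ici] at hr
      rw [(hd r (one_pos.trans hr)).deriv, ← div_eq_mul_inv]
      linarith [hder r (le_of_lt hr)]
  obtain ⟨r, hr, hr1⟩ := (((Real.tendsto_log_atTop.const_mul_atTop hc).eventually_gt_atTop
    (u 1 - l)).and (eventually_ge_atTop 1)).exists
  have h := hlog (mem_Ici.2 le_rfl) (mem_Ici.2 hr1) hr1
  simp only [Real.log_one, mul_zero, add_zero] at h
  linarith [hle r (one_pos.le.trans hr1)]

/-- If `R < ∞`, the limiting value at `R` does not exceed `u₀`. -/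
lemma IsRadialSolution.limit_toReal_Rend_le {p : ℝ} {n : ℕ} {K f u : ℝ → ℝ} {u₀ l : ℝ}
    (hu : IsRadialSolution p n K f (Ici 0) u) (hn : 2 ≤ n) (hu₀ : 0 < u₀)
    (hK : ∀ r, 0 < r → 0 < K r) (hf : ∀ v, u₀ < v → 0 < f v) (h0 : u₀ < u 0)
    (hR : Rend u ≠ ⊤) (hl : Tendsto u (𝓝[<] (Rend u).toReal) (𝓝 l)) : l ≤ u₀ := by
  by_contra! hlt
  set T := (Rend u).toReal
  have hT0 : 0 ≤ T := ENNReal.toReal_nonneg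
  have hc : ContinuousOn u (Ici 0) := hu.2.2.1.continuousOn
  have habove : ∀ t ∈ Icc 0 T, u₀ < u t := by
    rcases hT0.eq_or_lt with h | h
    · intro t ht
      rwa [show t = 0 by linarith [ht.1, ht.2]]
    · have hTl : u T = l := tendsto_nhds_unique
        ((hu.hasDerivAt h).continuousAt.tendsto.mono_left nhdsWithin_le_nhds) hl
      have hanti := (hu.strictAntiOn (r := T) fun t ht =>
        (pos_and_uderiv_neg_of_lt_Rend ht.1
          ((ENNReal.ofReal_lt_iff_lt_toReal ht.1.le hR).2 ht.2)).2).antitoneOn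
      intro t ht
      exact (hTl ▸ hlt).trans_le (hanti ht (right_mem_Icc.2 hT0) ht.2)
  have hev : ∀ᶠ t in 𝓝[≥] T, u₀ < u t :=
    ((hc T hT0).mono (Ici_subset_Ici.2 hT0)).eventually_const_lt
      (habove T (right_mem_Icc.2 hT0))
  obtain ⟨S, hTS, hS⟩ := mem_nhdsGE_iff_exists_Ico_subset.1 hev
  have hle := hu.ofReal_le_Rend hn hu₀ hK hf (r := S) fun t ht => by
    rcases le_total t T with h | h
    · exact habove t ⟨ht.1, h⟩
    · exact hS ⟨h, ht.2⟩
  exact absurd ((ENNReal.ofReal_le_iff_le_toReal hR).1 hle) (not_le.2 hTS)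

/-- Property (ii): the limiting value `u(R(α),α)` never exceeds `u₀`. -/
theorem limit_value_le_u0
    (p : ℝ) (n : ℕ) (hp : 1 < p) (hn : p < n)
    (K f : ℝ → ℝ) (u₀ : ℝ) (hu₀ : 0 < u₀)
    (hK : CondK1 p K) (hf1 : CondF1 f u₀) (hf2 : CondF2 f u₀)
    (u : ℝ → ℝ → ℝ) (hfam : IsFamily p n K f u₀ u)
    (uR : ℝ → ℝ)
    (huR : ∀ α : ℝ, u₀ < α → Tendsto (u α) (endFilter (Rend (u α))) (𝓝 (uR α))) :
    ∀ α : ℝ, u₀ < α → uR α ≤ u₀ := by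
  intro α hα
  obtain ⟨hu, h0, -⟩ := hfam.1 α hα
  have hl := huR α hα
  by_cases hR : Rend (u α) = ⊤
  · rw [endFilter, if_pos hR] at hl
    exact hu.limit_atTop_le hp hn hu₀ hK hf1.2.1 hf2.1
      (fun t ht => (pos_and_uderiv_neg_of_lt_Rend ht (hR ▸ ENNReal.ofReal_lt_top)).2) hl
  · rw [endFilter, if_neg hR] at hl
    have hn2 : 2 ≤ n := by
      have : (1 : ℝ) < n := hp.trans hn
      exact_mod_cast this
    exact hu.limit_toReal_Rend_le hn2 hu₀ hK.1 hf1.2.1 (h0.symm ▸ hα) hR hl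
end
end
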